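/- arXiv:1308.3193 — 2 statements merged into one kernel-verified Lean document; each statement's English description precedes it below -/
import Mathlib

section
/- For r ≤ 4, let b_1, ..., b_r ∈ ℝ^n (n ≥ r) satisfy ⟨b_i, b_j⟩ ≥ 0 for all i, j. Then there exists an orthogonal matrix Q ∈ ℝ^{n×n} such that Q b_i has all entries nonnegative for each i. -/
open Matrix BigOperators

section NonnegFactor

variable {E : Type*} [NormedAddCommGroup E] [InnerProductSpace ℝ E]

/-- The Gram matrix of `b` factors as `C * Cᵀ` with `C` a square entrywise nonnegative matrix. -/
def HasNonnegFactor {r : ℕ} (b : Fin r → E) : Prop :=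
  ∃ c : Fin r → Fin r → ℝ, (∀ i j, 0 ≤ c i j) ∧ ∀ i j, c i ⬝ᵥ c j = inner ℝ (b i) (b j)

/-- The `(j, k)` entry of the Gram matrix becomes negative after projecting away `b i`. -/
def ProjNeg {r : ℕ} (b : Fin r → E) (i j k : Fin r) : Prop :=
  inner ℝ (b i) (b i) * inner ℝ (b j) (b k) < inner ℝ (b i) (b j) * inner ℝ (b i) (b k)

lemma HasNonnegFactor.of_nonneg_comb {r : ℕ} {b b' : Fin r → E} (T : Matrix (Fin r) (Fin r) ℝ)
    (hT : ∀ i j, 0 ≤ T i j) (hb : ∀ i, b i = ∑ l, T i l • b' l) (h : HasNonnegFactor b') :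
    HasNonnegFactor b := by
  obtain ⟨c, hc, hg⟩ := h
  refine ⟨fun i => ∑ l, T i l • c l, fun i j => ?_, fun i j => ?_⟩
  · simpa only [Finset.sum_apply, Pi.smul_apply, smul_eq_mul] using
      Finset.sum_nonneg fun l _ => mul_nonneg (hT i l) (hc l j)
  · simp only [hb, sum_dotProduct, dotProduct_sum, smul_dotProduct, dotProduct_smul, hg,
      sum_inner, inner_sum, real_inner_smul_left, real_inner_smul_right, smul_eq_mul,
      Finset.mul_sum]

lemma HasNonnegFactor.of_perm {r : ℕ} {b : Fin r → E} (σ : Equiv.Perm (Fin r))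
    (h : HasNonnegFactor (b ∘ σ)) : HasNonnegFactor b := by
  obtain ⟨c, hc, hg⟩ := h
  exact ⟨fun i => c (σ.symm i), fun i j => hc _ j, fun i j => by simp [hg]⟩

namespace ProjNeg

variable {r : ℕ} {b : Fin r → E} {i j k : Fin r}

lemma symm (h : ProjNeg b i j k) : ProjNeg b i k j := by
  unfold ProjNeg at *
  rw [real_inner_comm (b j) (b k), mul_comm (inner ℝ (b i) (b k))]
  exact h

lemma ne_left (h : ProjNeg b i j k) : j ≠ i := by
  rintro rfl
  exact lt_irrefl _ h

lemma ne_right (h : ProjNeg b i j k) : k ≠ i := h.symm.ne_left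

lemma ne (h : ProjNeg b i j k) : j ≠ k := by
  rintro rfl
  exact absurd (real_inner_mul_inner_self_le (b i) (b j)) (not_le.2 h)

lemma pos_left (hb : ∀ i j, 0 ≤ inner ℝ (b i) (b j)) (h : ProjNeg b i j k) :
    0 < inner ℝ (b i) (b j) :=
  pos_of_mul_pos_left ((mul_nonneg (hb _ _) (hb _ _)).trans_lt h) (hb _ _)

lemma pos_right (hb : ∀ i j, 0 ≤ inner ℝ (b i) (b j)) (h : ProjNeg b i j k) :
    0 < inner ℝ (b i) (b k) := h.symm.pos_left hb

lemma not_other_vertex (hb : ∀ i j, 0 ≤ inner ℝ (b i) (b j)) (h : ProjNeg b i j k) :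
    ¬ ProjNeg b j i k := by
  intro h'
  have hij := h.pos_left hb
  have hik := h.pos_right hb
  have hjk := h'.pos_right hb
  have cs := real_inner_mul_inner_self_le (b i) (b j)
  unfold ProjNeg at h h'
  rw [real_inner_comm (b i) (b j)] at h'
  have := mul_lt_mul'' h h' (mul_nonneg (hb _ _) (hb _ _)) (mul_nonneg (hb _ _) (hb _ _))
  nlinarith [mul_le_mul_of_nonneg_right cs (mul_pos hik hjk).le]

lemma of_orthogonal {b : Fin 4 → E} (hb : ∀ i j, 0 ≤ inner ℝ (b i) (b j)) {i j k o m n : Fin 4}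
    (h : ProjNeg b i j k) (ho : inner ℝ (b i) (b o) = (0 : ℝ))
    (hcover : ∀ x, x = i ∨ x = o ∨ x = m ∨ x = n) : ProjNeg b i m n := by
  have hj : j ≠ o := by
    rintro rfl
    exact (h.pos_left hb).ne' ho
  have hk : k ≠ o := by
    rintro rfl
    exact (h.pos_right hb).ne' ho
  rcases hcover j with e | e | rfl | rfl
  · exact absurd e h.ne_left
  · exact absurd e hj
  · rcases hcover k with e | e | e | rfl
    exacts [absurd e h.ne_right, absurd e hk, absurd e.symm h.ne, h]
  · rcases hcover k with e | e | rfl | e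
    exacts [absurd e h.ne_right, absurd e hk, h.symm, absurd e.symm h.ne]

end ProjNeg

lemma hasNonnegFactor_of_proj_zero {m : ℕ} {b : Fin (m + 1) → E}
    (ih : ∀ b' : Fin m → E, (∀ i j, 0 ≤ inner ℝ (b' i) (b' j)) → HasNonnegFactor b')
    (hb : ∀ i j, 0 ≤ inner ℝ (b i) (b j)) (h : ∀ j k, ¬ ProjNeg b 0 j k) :
    HasNonnegFactor b := by
  have gram (j k : Fin m) :
      inner ℝ (b j.succ - (inner ℝ (b 0) (b j.succ) / inner ℝ (b 0) (b 0)) • b 0)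
        (b k.succ - (inner ℝ (b 0) (b k.succ) / inner ℝ (b 0) (b 0)) • b 0) =
      inner ℝ (b j.succ) (b k.succ) -
        inner ℝ (b 0) (b j.succ) * inner ℝ (b 0) (b k.succ) / inner ℝ (b 0) (b 0) := by
    simp only [inner_sub_left, inner_sub_right, real_inner_smul_left, real_inner_smul_right]
    rw [real_inner_comm (b 0) (b j.succ)]
    by_cases h0 : b 0 = 0
    · simp [h0]
    · have := inner_self_ne_zero (𝕜 := ℝ).2 h0
      field_simp
      ring
  obtain ⟨c, hc, hg⟩ := ih
    (fun j => b j.succ - (inner ℝ (b 0) (b j.succ) / inner ℝ (b 0) (b 0)) • b 0) (by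
      intro j k
      rw [gram]
      have := not_lt.1 (h j.succ k.succ)
      rcases (hb 0 0).eq_or_lt with h0 | h0
      · simpa [← h0, -inner_self_eq_norm_sq_to_K] using hb j.succ k.succ
      · rw [sub_nonneg, div_le_iff₀ h0, mul_comm (inner ℝ (b j.succ) (b k.succ))]
        exact this)
  have norm_mul (j : Fin m) : ‖b 0‖ * (inner ℝ (b 0) (b j.succ) / ‖b 0‖) =
      inner ℝ (b 0) (b j.succ) := by
    by_cases h0 : b 0 = 0
    · simp [h0]
    · field_simp
  refine ⟨Fin.cons (Fin.cons ‖b 0‖ 0)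
    (fun j => Fin.cons (inner ℝ (b 0) (b j.succ) / ‖b 0‖) (c j)), fun i j => ?_, fun i j => ?_⟩
  · refine Fin.cases ?_ (fun i => ?_) i <;> refine Fin.cases ?_ (fun j => ?_) j
    · simp
    · simp
    · simpa using div_nonneg (hb _ _) (norm_nonneg _)
    · simpa using hc i j
  · refine Fin.cases ?_ (fun i => ?_) i <;> refine Fin.cases ?_ (fun j => ?_) j
    · simp [dotProduct, Fin.sum_univ_succ, sq]
    · simpa [dotProduct, Fin.sum_univ_succ] using norm_mul j
    · simpa [dotProduct, Fin.sum_univ_succ, mul_comm, real_inner_comm] using norm_mul i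
    · have := (hg i j).trans (gram i j)
      simp only [dotProduct] at this
      simp only [dotProduct, Fin.sum_univ_succ, Fin.cons_succ, Fin.cons_zero, this]
      rw [div_mul_div_comm, ← real_inner_self_eq_norm_mul_norm]
      ring

lemma hasNonnegFactor_of_proj {m : ℕ} {b : Fin (m + 1) → E}
    (ih : ∀ b' : Fin m → E, (∀ i j, 0 ≤ inner ℝ (b' i) (b' j)) → HasNonnegFactor b')
    (hb : ∀ i j, 0 ≤ inner ℝ (b i) (b j)) (i : Fin (m + 1)) (h : ∀ j k, ¬ ProjNeg b i j k) :
    HasNonnegFactor b := by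
  refine .of_perm (Equiv.swap 0 i)
    (hasNonnegFactor_of_proj_zero ih (fun _ _ => hb _ _) fun j k hjk => ?_)
  refine h (Equiv.swap 0 i j) (Equiv.swap 0 i k) ?_
  simpa [ProjNeg] using hjk

lemma hasNonnegFactor_zero (b : Fin 0 → E) : HasNonnegFactor b :=
  ⟨0, fun i => i.elim0, fun i => i.elim0⟩

lemma hasNonnegFactor_one (b : Fin 1 → E) (hb : ∀ i j, 0 ≤ inner ℝ (b i) (b j)) :
    HasNonnegFactor b :=
  hasNonnegFactor_of_proj (fun b' _ => hasNonnegFactor_zero b') hb 0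
    fun j k h => h.ne (Subsingleton.elim (α := Fin 1) j k)

lemma hasNonnegFactor_two (b : Fin 2 → E) (hb : ∀ i j, 0 ≤ inner ℝ (b i) (b j)) :
    HasNonnegFactor b :=
  hasNonnegFactor_of_proj hasNonnegFactor_one hb 0
    fun j k h => by
      have := h.ne
      have := h.ne_left
      have := h.ne_right
      omega

lemma hasNonnegFactor_three (b : Fin 3 → E) (hb : ∀ i j, 0 ≤ inner ℝ (b i) (b j)) :
    HasNonnegFactor b := by
  have exists_neg : ∀ i, ¬ HasNonnegFactor b → ∃ j k, ProjNeg b i j k := by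
    intro i hn
    by_contra! h
    exact hn (hasNonnegFactor_of_proj hasNonnegFactor_two hb i h)
  by_contra hn
  obtain ⟨j, k, h⟩ := exists_neg 0 hn
  obtain ⟨j', k', h'⟩ := exists_neg 1 hn
  have h₀ : ProjNeg b 0 1 2 := by
    have h1 := h.ne
    have h2 := h.ne_left
    have h3 := h.ne_right
    obtain ⟨rfl, rfl⟩ | ⟨rfl, rfl⟩ : (j = 1 ∧ k = 2) ∨ (j = 2 ∧ k = 1) := by omega
    exacts [h, h.symm]
  have h₁ : ProjNeg b 1 0 2 := by
    have h1 := h'.ne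
    have h2 := h'.ne_left
    have h3 := h'.ne_right
    obtain ⟨rfl, rfl⟩ | ⟨rfl, rfl⟩ : (j' = 0 ∧ k' = 2) ∨ (j' = 2 ∧ k' = 0) := by omega
    exacts [h', h'.symm]
  exact h₀.not_other_vertex hb h₁

/-- Subtracting from `b j` its projection on `b k` is harmless if the Gram matrix stays
nonnegative. -/
lemma exists_orthogonalized {r : ℕ} {b : Fin r → E} (hb : ∀ i j, 0 ≤ inner ℝ (b i) (b j))
    {j k : Fin r} (hjk : j ≠ k) (h : ∀ m, ¬ ProjNeg b k j m) :
    ∃ b' : Fin r → E, (∀ i j, 0 ≤ inner ℝ (b' i) (b' j)) ∧ inner ℝ (b' j) (b' k) = 0 ∧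
      (∀ m, m ≠ j → b' m = b m) ∧ (HasNonnegFactor b' → HasNonnegFactor b) := by
  set t : ℝ := inner ℝ (b k) (b j) / inner ℝ (b k) (b k) with ht
  have ht0 : 0 ≤ t := div_nonneg (hb _ _) (hb _ _)
  have entry (m : Fin r) : 0 ≤ inner ℝ (b j - t • b k) (b m) := by
    rw [inner_sub_left, real_inner_smul_left, ht]
    have := not_lt.1 (h m)
    rcases (hb k k).eq_or_lt with h0 | h0
    · simpa [← h0, -inner_self_eq_norm_sq_to_K] using hb j m
    · rw [sub_nonneg, div_mul_eq_mul_div, div_le_iff₀ h0, mul_comm (inner ℝ (b j) (b m))]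
      exact this
  refine ⟨Function.update b j (b j - t • b k), fun i l => ?_, ?_, fun m hm => by simp [hm],
    fun h' => h'.of_nonneg_comb (1 + Matrix.single j k t) (fun i l => ?_) fun i => ?_⟩
  · by_cases hi : i = j <;> by_cases hl : l = j
    · subst hi; subst hl
      exact real_inner_self_nonneg
    · subst hi
      simpa [hl] using entry l
    · subst hl
      simpa [hi, real_inner_comm] using entry i
    · simpa [hi, hl] using hb i l
  · rw [Function.update_self, Function.update_of_ne hjk.symm, inner_sub_left,
      real_inner_smul_left, ht, real_inner_comm (b k) (b j)]
    by_cases h0 : b k = 0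
    · simp [h0]
    · rw [div_mul_cancel₀ _ (inner_self_ne_zero.2 h0), sub_self]
  · rw [Matrix.add_apply, Matrix.one_apply, Matrix.single_apply]
    positivity
  · simp only [Matrix.add_apply, add_smul, Finset.sum_add_distrib, Matrix.one_apply,
      Matrix.single_apply, ite_smul, one_smul, zero_smul, Finset.sum_ite_eq, Finset.mem_univ,
      if_true]
    by_cases hi : i = j
    · subst hi
      simp [hjk.symm]
    · simp [hi, Ne.symm hi]

/-- If projecting away `b i` makes the `(j, k)` entry negative, then `b j` and `b k` can be made
orthogonal without changing the other two vectors. -/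
lemma ProjNeg.exists_orthogonalized_pair {b : Fin 4 → E} (hb : ∀ i j, 0 ≤ inner ℝ (b i) (b j))
    {i j k : Fin 4} (h : ProjNeg b i j k) :
    ∃ b' : Fin 4 → E, (∀ i j, 0 ≤ inner ℝ (b' i) (b' j)) ∧ inner ℝ (b' j) (b' k) = 0 ∧
      (∀ m, m ≠ j → m ≠ k → b' m = b m) ∧ (HasNonnegFactor b' → HasNonnegFactor b) := by
  by_cases h₁ : ∀ m, ¬ ProjNeg b k j m
  · obtain ⟨b', h1, h2, h3, h4⟩ := exists_orthogonalized hb h.ne h₁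
    exact ⟨b', h1, h2, fun m hm _ => h3 m hm, h4⟩
  by_cases h₂ : ∀ m, ¬ ProjNeg b j k m
  · obtain ⟨b', h1, h2, h3, h4⟩ := exists_orthogonalized hb h.ne.symm h₂
    exact ⟨b', h1, by rw [real_inner_comm]; exact h2, fun m _ hm => h3 m hm, h4⟩
  push Not at h₁ h₂
  obtain ⟨m, hm⟩ := h₁
  obtain ⟨m', hm'⟩ := h₂
  have hmi : m ≠ i := by
    rintro rfl
    exact h.symm.not_other_vertex hb hm.symm
  have hmi' : m' ≠ i := by
    rintro rfl
    exact h.not_other_vertex hb hm'.symm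
  have e : m = m' := by
    have := h.ne
    have := h.ne_left
    have := h.ne_right
    have := hm.ne
    have := hm.ne_right
    have := hm'.ne
    have := hm'.ne_right
    omega
  subst e
  exact absurd hm' (hm.not_other_vertex hb)

lemma exists_edge_weights {p q r s : ℝ} (hp : 0 < p) (hq : 0 < q) (hr : 0 < r) (hs : 0 < s)
    (hL : 0 ≤ 1 - p ^ 2 - q ^ 2)
    (h : (p * r + q * s) ^ 2 ≤ (1 - p ^ 2 - q ^ 2) * (1 - r ^ 2 - s ^ 2)) :
    ∃ x y z w : ℝ, 0 < x ∧ 0 < y ∧ 0 < z ∧ 0 < w ∧ x ^ 2 + y ^ 2 = 1 ∧ z ^ 2 + w ^ 2 = 1 ∧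
      (p / x) ^ 2 + (r / z) ^ 2 = 1 ∧ (q / y) ^ 2 + (s / w) ^ 2 = 1 := by
  set L := 1 - p ^ 2 - q ^ 2 with hLdef
  set K := 1 - r ^ 2 - s ^ 2
  have hpr := mul_pos hp hr
  have hqs := mul_pos hq hs
  have hw : 0 < p * r + q * s := by positivity
  have hLpos : 0 < L := by
    refine hL.lt_of_ne fun h0 => ?_
    rw [← h0, zero_mul] at h
    exact absurd h (not_le.2 (by positivity))
  set f : ℝ → ℝ := fun t => (p * r) ^ 2 * (L - t) + (q * s) ^ 2 * t - K * (t * (L - t)) with hf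
  set t₀ := L * (p * r) / (p * r + q * s) with ht₀
  have ht₀L : L - t₀ = L * (q * s) / (p * r + q * s) := by
    rw [ht₀]; field_simp; ring
  have ht₀pos : 0 < t₀ := by positivity
  have hLt₀ : 0 < L - t₀ := by rw [ht₀L]; positivity
  have hf0 : 0 < f 0 := by simp only [hf]; simp; positivity
  have hft₀ : f t₀ ≤ 0 := by
    have : f t₀ = L * (p * r) * (q * s) / (p * r + q * s) ^ 2 *
        ((p * r + q * s) ^ 2 - L * K) := by
      simp only [hf]
      rw [ht₀L, ht₀]
      field_simp
    rw [this]
    exact mul_nonpos_of_nonneg_of_nonpos (by positivity) (by linarith)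
  obtain ⟨t, ⟨ht0, htt⟩, hft⟩ := intermediate_value_Icc' ht₀pos.le
    (f := f) (by fun_prop) ⟨hft₀, hf0.le⟩
  have htpos : 0 < t := by
    refine ht0.lt_of_ne ?_
    rintro rfl
    exact hf0.ne' hft
  have hLt : 0 < L - t := by linarith
  simp only [hf] at hft
  have key : (p * r) ^ 2 / t + (q * s) ^ 2 / (L - t) = K := by
    field_simp
    linarith
  refine ⟨√(p ^ 2 + t), √(q ^ 2 + (L - t)), √(r ^ 2 + (p * r) ^ 2 / t),
    √(s ^ 2 + (q * s) ^ 2 / (L - t)), by positivity, by positivity, by positivity,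
    by positivity, ?_, ?_, ?_, ?_⟩
  · rw [Real.sq_sqrt (by positivity), Real.sq_sqrt (by positivity)]
    linarith
  · rw [Real.sq_sqrt (by positivity), Real.sq_sqrt (by positivity)]
    linarith
  · rw [div_pow, div_pow, Real.sq_sqrt (by positivity), Real.sq_sqrt (by positivity)]
    field_simp
    ring
  · rw [div_pow, div_pow, Real.sq_sqrt (by positivity), Real.sq_sqrt (by positivity)]
    generalize L - t = u at hLt
    field_simp
    ring

lemma hasNonnegFactor_of_unit {b : Fin 4 → E} (hn : ∀ i, ‖b i‖ = 1)
    (h02 : inner ℝ (b 0) (b 2) = (0 : ℝ)) (h13 : inner ℝ (b 1) (b 3) = (0 : ℝ))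
    (h01 : 0 < inner ℝ (b 0) (b 1)) (h03 : 0 < inner ℝ (b 0) (b 3))
    (h21 : 0 < inner ℝ (b 2) (b 1)) (h23 : 0 < inner ℝ (b 2) (b 3)) : HasNonnegFactor b := by
  set p : ℝ := inner ℝ (b 0) (b 1) with hp
  set q : ℝ := inner ℝ (b 0) (b 3) with hq
  set r : ℝ := inner ℝ (b 2) (b 1) with hr
  set s : ℝ := inner ℝ (b 2) (b 3) with hs
  have hu (i : Fin 4) : inner ℝ (b i) (b i) = (1 : ℝ) := by
    rw [real_inner_self_eq_norm_sq, hn, one_pow]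
  have h10 : inner ℝ (b 1) (b 0) = p := real_inner_comm _ _
  have h30 : inner ℝ (b 3) (b 0) = q := real_inner_comm _ _
  have h12 : inner ℝ (b 1) (b 2) = r := real_inner_comm _ _
  have h32 : inner ℝ (b 3) (b 2) = s := real_inner_comm _ _
  have h31 : inner ℝ (b 3) (b 1) = (0 : ℝ) := by rw [real_inner_comm, h13]
  have h20 : inner ℝ (b 2) (b 0) = (0 : ℝ) := by rw [real_inner_comm, h02]
  set u := b 0 - p • b 1 - q • b 3 with hudef
  set v := b 2 - r • b 1 - s • b 3 with hvdef
  have huu : inner ℝ u u = 1 - p ^ 2 - q ^ 2 := by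
    simp only [hudef, inner_sub_left, inner_sub_right, real_inner_smul_left,
      real_inner_smul_right, hu, h10, h30, h13, h31, ← hp, ← hq]
    ring
  have hvv : inner ℝ v v = 1 - r ^ 2 - s ^ 2 := by
    simp only [hvdef, inner_sub_left, inner_sub_right, real_inner_smul_left,
      real_inner_smul_right, hu, h12, h32, h13, h31, ← hr, ← hs]
    ring
  have huv : inner ℝ u v = -(p * r + q * s) := by
    simp only [hudef, hvdef, inner_sub_left, inner_sub_right, real_inner_smul_left,
      real_inner_smul_right, hu, h12, h32, h13, h31, h02, ← hp, ← hq]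
    ring
  obtain ⟨x, y, z, w, hx, hy, hz, hw, hxy, hzw, hxz, hyw⟩ := exists_edge_weights h01 h03 h21 h23
    (huu ▸ real_inner_self_nonneg) (by
      have := real_inner_mul_inner_self_le u v
      rw [huu, hvv, huv] at this
      linarith)
  have c1 : p / x * x = p := div_mul_cancel₀ _ hx.ne'
  have c2 : q / y * y = q := div_mul_cancel₀ _ hy.ne'
  have c3 : r / z * z = r := div_mul_cancel₀ _ hz.ne'
  have c4 : s / w * w = s := div_mul_cancel₀ _ hw.ne'
  refine ⟨![![x, y, 0, 0], ![p / x, 0, r / z, 0], ![0, 0, z, w], ![0, q / y, 0, s / w]],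
    fun i j => ?_, fun i j => ?_⟩
  · fin_cases i <;> fin_cases j <;> simp <;> positivity
  · fin_cases i <;> fin_cases j <;>
      simp [dotProduct, Fin.sum_univ_four, hn, h02, h13, h10, h30, h12, h32, h31, h20,
        ← hp, ← hq, ← hr, ← hs] <;> linarith

lemma hasNonnegFactor_of_orthogonal_pairs {b : Fin 4 → E}
    (hb : ∀ i j, 0 ≤ inner ℝ (b i) (b j))
    (h02 : inner ℝ (b 0) (b 2) = (0 : ℝ)) (h13 : inner ℝ (b 1) (b 3) = (0 : ℝ)) :
    HasNonnegFactor b := by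
  by_cases g0 : ∀ j k, ¬ ProjNeg b 0 j k
  · exact hasNonnegFactor_of_proj hasNonnegFactor_three hb 0 g0
  by_cases g2 : ∀ j k, ¬ ProjNeg b 2 j k
  · exact hasNonnegFactor_of_proj hasNonnegFactor_three hb 2 g2
  push Not at g0 g2
  obtain ⟨j, k, n0⟩ := g0
  obtain ⟨j', k', n2⟩ := g2
  replace n0 : ProjNeg b 0 1 3 := n0.of_orthogonal hb h02 (by decide)
  replace n2 : ProjNeg b 2 1 3 :=
    n2.of_orthogonal hb (o := 0) (by rw [real_inner_comm, h02]) (by decide)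
  have p01 := n0.pos_left hb
  have p03 := n0.pos_right hb
  have p21 := n2.pos_left hb
  have p23 := n2.pos_right hb
  have h0 : ∀ i, b i ≠ 0 := by
    intro i hi
    fin_cases i <;> simp_all
  have scaled (i j : Fin 4) : inner ℝ (‖b i‖⁻¹ • b i) (‖b j‖⁻¹ • b j) =
      ‖b i‖⁻¹ * (‖b j‖⁻¹ * inner ℝ (b i) (b j)) := by
    rw [real_inner_smul_left, real_inner_smul_right]
  have pos (i : Fin 4) : 0 < ‖b i‖⁻¹ := inv_pos.2 (norm_pos_iff.2 (h0 i))
  have unit_factor : HasNonnegFactor fun i => ‖b i‖⁻¹ • b i := by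
    refine hasNonnegFactor_of_unit (fun i => norm_smul_inv_norm (𝕜 := ℝ) (h0 i))
      ?_ ?_ ?_ ?_ ?_ ?_ <;> rw [scaled]
    · rw [h02, mul_zero, mul_zero]
    · rw [h13, mul_zero, mul_zero]
    · exact mul_pos (pos 0) (mul_pos (pos 1) p01)
    · exact mul_pos (pos 0) (mul_pos (pos 3) p03)
    · exact mul_pos (pos 2) (mul_pos (pos 1) p21)
    · exact mul_pos (pos 2) (mul_pos (pos 3) p23)
  refine unit_factor.of_nonneg_comb (Matrix.diagonal fun i => ‖b i‖) (fun i j => ?_) fun i => ?_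
  · rw [Matrix.diagonal_apply]
    positivity
  · simp [Matrix.diagonal_apply, ite_smul, smul_smul, h0 i]

lemma hasNonnegFactor_of_orthogonal_pair {b : Fin 4 → E}
    (hb : ∀ i j, 0 ≤ inner ℝ (b i) (b j)) (h02 : inner ℝ (b 0) (b 2) = (0 : ℝ)) :
    HasNonnegFactor b := by
  by_cases g : ∀ j k, ¬ ProjNeg b 0 j k
  · exact hasNonnegFactor_of_proj hasNonnegFactor_three hb 0 g
  push Not at g
  obtain ⟨j, k, h⟩ := g
  have h' : ProjNeg b 0 1 3 := h.of_orthogonal hb h02 (by decide)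
  obtain ⟨b', hb', ho, he, hf⟩ := h'.exists_orthogonalized_pair hb
  refine hf (hasNonnegFactor_of_orthogonal_pairs hb' ?_ ho)
  rw [he 0 (by decide) (by decide), he 2 (by decide) (by decide), h02]

lemma hasNonnegFactor_four (b : Fin 4 → E) (hb : ∀ i j, 0 ≤ inner ℝ (b i) (b j)) :
    HasNonnegFactor b := by
  by_cases g : ∀ j k, ¬ ProjNeg b 0 j k
  · exact hasNonnegFactor_of_proj hasNonnegFactor_three hb 0 g
  push Not at g
  obtain ⟨j, k, h⟩ := g
  obtain ⟨b', hb', ho, -, hf⟩ := h.exists_orthogonalized_pair hb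
  obtain ⟨σ, hσ, hσ'⟩ : ∃ σ : Equiv.Perm (Fin 4), σ 0 = j ∧ σ 2 = k := by
    have : ∀ j k : Fin 4, j ≠ k → ∃ σ : Equiv.Perm (Fin 4), σ 0 = j ∧ σ 2 = k := by decide
    exact this j k h.ne
  exact hf (.of_perm σ (hasNonnegFactor_of_orthogonal_pair (fun _ _ => hb' _ _)
    (by simpa [hσ, hσ'] using ho)))

lemma hasNonnegFactor_of_le_four {r : ℕ} (hr : r ≤ 4) (b : Fin r → E)
    (hb : ∀ i j, 0 ≤ inner ℝ (b i) (b j)) : HasNonnegFactor b := by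
  interval_cases r
  exacts [hasNonnegFactor_zero b, hasNonnegFactor_one b hb, hasNonnegFactor_two b hb,
    hasNonnegFactor_three b hb, hasNonnegFactor_four b hb]

/-- Families with the same Gram matrix differ by an isometry. -/
lemma exists_linearIsometry_of_inner_eq [FiniteDimensional ℝ E] {ι : Type*} [Fintype ι]
    {b c : ι → E} (h : ∀ i j, inner ℝ (c i) (c j) = (inner ℝ (b i) (b j) : ℝ)) :
    ∃ f : E →ₗᵢ[ℝ] E, ∀ i, f (b i) = c i := by
  classical
  set B := Fintype.linearCombination ℝ b with hB
  set C := Fintype.linearCombination ℝ c with hC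
  have hn (x : ι → ℝ) : ‖C x‖ = ‖B x‖ := by
    rw [← sq_eq_sq₀ (norm_nonneg _) (norm_nonneg _), ← real_inner_self_eq_norm_sq,
      ← real_inner_self_eq_norm_sq]
    simp only [hB, hC, Fintype.linearCombination_apply, sum_inner, inner_sum,
      real_inner_smul_left, real_inner_smul_right, h]
  obtain ⟨g, hg⟩ := B.rangeRestrict.exists_rightInverse_of_surjective B.range_rangeRestrict
  have hg' (y : LinearMap.range B) : B (g y) = y :=
    congrArg Subtype.val (LinearMap.congr_fun hg y)
  let φ : LinearMap.range B →ₗᵢ[ℝ] E :=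
    ⟨C ∘ₗ g, fun y => by rw [LinearMap.comp_apply, hn, hg', Submodule.coe_norm]⟩
  have hφ (x : ι → ℝ) : φ (B.rangeRestrict x) = C x := by
    change C (g _) = C x
    rw [← sub_eq_zero, ← map_sub, ← norm_eq_zero, hn, map_sub, hg', LinearMap.rangeRestrict,
      LinearMap.codRestrict_apply,
      sub_self, norm_zero]
  refine ⟨φ.extend, fun i => ?_⟩
  have e := φ.extend_apply (B.rangeRestrict (Pi.single i 1))
  rw [hφ] at e
  simpa [hB, hC] using e

end NonnegFactor

theorem stmt_14 (r n : ℕ) (hr : r ≤ 4) (hn : r ≤ n) (b : Fin r → Fin n → ℝ)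
    (h : ∀ i j, 0 ≤ ∑ k, b i k * b j k) :
    ∃ Q : Matrix (Fin n) (Fin n) ℝ, Qᵀ * Q = 1 ∧ ∀ i j, 0 ≤ Q.mulVec (b i) j := by
  obtain ⟨d, rfl⟩ := Nat.exists_eq_add_of_le hn
  let v (i : Fin r) : EuclideanSpace ℝ (Fin (r + d)) := WithLp.toLp 2 (b i)
  obtain ⟨c, hc, hg⟩ := hasNonnegFactor_of_le_four hr v fun i j => by
    simpa [v, PiLp.inner_apply, mul_comm] using h i j
  let w (i : Fin r) : EuclideanSpace ℝ (Fin (r + d)) := WithLp.toLp 2 (Fin.append (c i) 0)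
  obtain ⟨f, hf⟩ := exists_linearIsometry_of_inner_eq (b := v) (c := w) fun i j => by
    rw [← hg]
    simp [w, PiLp.inner_apply, Fin.sum_univ_add, dotProduct, mul_comm]
  refine ⟨.of fun i j => f (EuclideanSpace.single j 1) i, ?_, fun i j => ?_⟩
  · ext i j
    have := f.inner_map_map (EuclideanSpace.single i 1) (EuclideanSpace.single j 1)
    rw [EuclideanSpace.inner_single_left, PiLp.inner_apply] at this
    simpa [Matrix.mul_apply, Matrix.one_apply, mul_comm, Pi.single_apply, eq_comm] using this
  · have hv : v i = ∑ k, b i k • EuclideanSpace.single k (1 : ℝ) := by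
      ext k
      simp [v, Pi.single_apply]
    have key : (Matrix.of fun i j => f (EuclideanSpace.single j 1) i).mulVec (b i) j = w i j := by
      rw [← hf, hv]
      simp [Matrix.mulVec, dotProduct, mul_comm]
    rw [key]
    refine Fin.addCases (fun j => ?_) (fun j => ?_) j
    · simpa [w] using hc i j
    · simp [w]
end

section
/- Let A be an n×n doubly nonnegative matrix of rank r such that the convex cone generated by the columns of A has m ≤ 4 extreme rays. Then A is completely positive with cp-rank(A) ≤ m. -/
open Matrix BigOperators

def Matrix.IsCP {n : Type*} [Fintype n] (A : Matrix n n ℝ) : Prop :=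
  ∃ (m : ℕ) (B : Matrix (Fin m) n ℝ), (∀ i j, 0 ≤ B i j) ∧ A = Bᵀ * B

noncomputable def Matrix.cpRank {n : Type*} [Fintype n] (A : Matrix n n ℝ) : ℕ :=
  sInf {m | ∃ B : Matrix (Fin m) n ℝ, (∀ i j, 0 ≤ B i j) ∧ A = Bᵀ * B}

def coneOfColumns {n : ℕ} (A : Matrix (Fin n) (Fin n) ℝ) : Set (Fin n → ℝ) :=
  {x | ∃ c : Fin n → ℝ, (∀ j, 0 ≤ c j) ∧ x = ∑ j, c j • (fun i => A i j)}

def IsExtremeVec {n : ℕ} (C : Set (Fin n → ℝ)) (v : Fin n → ℝ) : Prop :=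
  v ≠ 0 ∧ v ∈ C ∧ ∀ a ∈ C, ∀ b ∈ C, v = a + b → ∃ t : ℝ, 0 ≤ t ∧ a = t • v

theorem Matrix.PosSemidef.sq_apply_le {n : Type*} [Fintype n] {A : Matrix n n ℝ}
    (hA : A.PosSemidef) (i j : n) : A i j ^ 2 ≤ A i i * A j j := by
  classical
  have hdet := (hA.submatrix ![i, j]).det_nonneg
  have hsymm : A j i = A i j := by simpa using hA.isHermitian.apply i j
  rw [Matrix.det_fin_two] at hdet
  simp only [Matrix.submatrix_apply, Matrix.cons_val_zero, Matrix.cons_val_one, hsymm] at hdet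
  nlinarith

/-- The Schur complement of the top left entry; for a positive semidefinite matrix whose top left
entry vanishes, this is the matrix with its first row and column removed. -/
noncomputable def Matrix.schurHead {k : ℕ} (A : Matrix (Fin (k + 1)) (Fin (k + 1)) ℝ) :
    Matrix (Fin k) (Fin k) ℝ :=
  fun i j => A i.succ j.succ - A 0 i.succ * A 0 j.succ / A 0 0

/-- The first row of the Cholesky factor. -/
noncomputable def Matrix.cholHead {k : ℕ} (A : Matrix (Fin (k + 1)) (Fin (k + 1)) ℝ) :
    Fin (k + 1) → ℝ :=
  fun j => A 0 j / √(A 0 0)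

section Schur

variable {k : ℕ} {A : Matrix (Fin (k + 1)) (Fin (k + 1)) ℝ}

theorem Matrix.PosSemidef.schurHead (hA : A.PosSemidef) : A.schurHead.PosSemidef := by
  have hsymm : ∀ i j, A j i = A i j := fun i j => by simpa using hA.isHermitian.apply i j
  refine Matrix.PosSemidef.of_dotProduct_mulVec_nonneg ?_ fun x => ?_
  · ext i j
    simp [Matrix.schurHead, hsymm i.succ j.succ, mul_comm]
  · have h := hA.dotProduct_mulVec_nonneg
      (Fin.cons (-(∑ j, A 0 j.succ * x j) / A 0 0) x : Fin (k + 1) → ℝ)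
    simp only [dotProduct, mulVec, Fin.sum_univ_succ, Fin.cons_zero, Fin.cons_succ, star_trivial,
      Pi.star_apply, hsymm 0 (Fin.succ _)] at h ⊢
    have hS : ∀ i, ∑ j, A.schurHead i j * x j
        = ∑ j, A i.succ j.succ * x j - A 0 i.succ * (∑ j, A 0 j.succ * x j) / A 0 0 := by
      intro i
      rw [mul_div_assoc, Finset.sum_div, Finset.mul_sum, ← Finset.sum_sub_distrib]
      refine Finset.sum_congr rfl fun j _ => ?_
      simp only [Matrix.schurHead]
      ring
    simp only [hS]
    set L := ∑ j, A 0 j.succ * x j with hL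
    have h₁ : ∑ i, x i * (∑ j, A i.succ j.succ * x j - A 0 i.succ * L / A 0 0)
        = ∑ i, x i * ∑ j, A i.succ j.succ * x j - L * L / A 0 0 := by
      conv_rhs => rw [mul_div_assoc, hL, Finset.sum_mul, ← hL]
      rw [← Finset.sum_sub_distrib]
      exact Finset.sum_congr rfl fun i _ => by ring
    have h₂ : ∑ i, x i * (A 0 i.succ * (-L / A 0 0) + ∑ j, A i.succ j.succ * x j)
        = ∑ i, x i * ∑ j, A i.succ j.succ * x j - L * L / A 0 0 := by
      conv_rhs => rw [mul_div_assoc, hL, Finset.sum_mul, ← hL]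
      rw [← Finset.sum_sub_distrib]
      exact Finset.sum_congr rfl fun i _ => by ring
    rw [h₂] at h
    rw [h₁]
    have h₃ : -L / A 0 0 * (A 0 0 * (-L / A 0 0) + L) = 0 := by
      rcases eq_or_ne (A 0 0) 0 with h0 | h0
      · simp [h0]
      · field_simp
        ring
    linarith

theorem Matrix.cholHead_nonneg (hA : ∀ j, 0 ≤ A 0 j) (j : Fin (k + 1)) : 0 ≤ A.cholHead j :=
  div_nonneg (hA j) (Real.sqrt_nonneg _)

theorem Matrix.PosSemidef.cholHead_zero_mul (hA : A.PosSemidef) (j : Fin (k + 1)) :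
    A.cholHead 0 * A.cholHead j = A 0 j := by
  have h0 : 0 ≤ A 0 0 := hA.diag_nonneg
  have hj := hA.sq_apply_le 0 j
  rcases h0.eq_or_lt with h | h
  · rw [← h] at hj
    have : A 0 j = 0 := by nlinarith
    simp [Matrix.cholHead, this]
  · have := Real.sqrt_pos.2 h
    have hs := Real.sq_sqrt h0
    simp only [Matrix.cholHead]
    field_simp
    linear_combination (-A 0 j) * hs

theorem Matrix.PosSemidef.cholHead_mul_add (hA : A.PosSemidef) (i j : Fin k) :
    A.cholHead i.succ * A.cholHead j.succ + A.schurHead i j = A i.succ j.succ := by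
  have h0 : 0 ≤ A 0 0 := hA.diag_nonneg
  simp only [Matrix.cholHead, Matrix.schurHead, div_mul_div_comm, Real.mul_self_sqrt h0]
  ring

theorem Matrix.schurHead_nonneg (h0 : 0 < A 0 0) {i j : Fin k}
    (h : A 0 i.succ * A 0 j.succ ≤ A 0 0 * A i.succ j.succ) : 0 ≤ A.schurHead i j := by
  rw [Matrix.schurHead, sub_nonneg, div_le_iff₀ h0]
  linarith

theorem Matrix.PosSemidef.exists_nonneg_factor_of_schurHead (hA : A.PosSemidef)
    (hnn : ∀ j, 0 ≤ A 0 j)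
    (h : ∃ B : Matrix (Fin k) (Fin k) ℝ, (∀ i j, 0 ≤ B i j) ∧ A.schurHead = Bᵀ * B) :
    ∃ B : Matrix (Fin (k + 1)) (Fin (k + 1)) ℝ, (∀ i j, 0 ≤ B i j) ∧ A = Bᵀ * B := by
  obtain ⟨B, hB, hS⟩ := h
  have hsymm : ∀ i j, A j i = A i j := fun i j => by simpa using hA.isHermitian.apply i j
  refine ⟨Matrix.of (Fin.cons A.cholHead fun i => Fin.cons 0 (B i)), ?_, ?_⟩
  · intro i j
    refine Fin.cases ?_ (fun i => ?_) i
    · simpa using Matrix.cholHead_nonneg hnn j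
    · refine Fin.cases ?_ (fun j => ?_) j
      · simp
      · simpa using hB i j
  · ext i j
    refine Fin.cases ?_ (fun i => ?_) i
    · simp [Matrix.mul_apply, Fin.sum_univ_succ, hA.cholHead_zero_mul]
    · refine Fin.cases ?_ (fun j => ?_) j
      · rw [hsymm 0 i.succ, ← hA.cholHead_zero_mul, mul_comm]
        simp [Matrix.mul_apply, Fin.sum_univ_succ]
      · rw [← hA.cholHead_mul_add, hS]
        simp [Matrix.mul_apply, Fin.sum_univ_succ]

end Schur

theorem Matrix.PosSemidef.exists_nonneg_factor_fin_one {A : Matrix (Fin 1) (Fin 1) ℝ}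
    (hA : A.PosSemidef) :
    ∃ B : Matrix (Fin 1) (Fin 1) ℝ, (∀ i j, 0 ≤ B i j) ∧ A = Bᵀ * B :=
  hA.exists_nonneg_factor_of_schurHead
    (fun j => by rw [show j = 0 from Fin.fin_one_eq_zero j]; exact hA.diag_nonneg)
    ⟨0, fun i => i.elim0, Subsingleton.elim _ _⟩

theorem Matrix.PosSemidef.exists_nonneg_factor_fin_two {A : Matrix (Fin 2) (Fin 2) ℝ}
    (hA : A.PosSemidef) (hnn : ∀ j, 0 ≤ A 0 j) :
    ∃ B : Matrix (Fin 2) (Fin 2) ℝ, (∀ i j, 0 ≤ B i j) ∧ A = Bᵀ * B :=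
  hA.exists_nonneg_factor_of_schurHead hnn hA.schurHead.exists_nonneg_factor_fin_one

/-- Vectors `(1, 0)`, `(x, α)`, `(y, γ)` of the plane with nonnegative pairwise inner products can
be moved into the closed first quadrant by an isometry. -/
theorem exists_quadrant_isometry {x y α γ : ℝ} (hx : 0 ≤ x) (hy : 0 ≤ y)
    (h : 0 ≤ x * y + α * γ) :
    ∃ c₁ c₂ x₁ x₂ y₁ y₂ : ℝ, 0 ≤ c₁ ∧ 0 ≤ c₂ ∧ 0 ≤ x₁ ∧ 0 ≤ x₂ ∧ 0 ≤ y₁ ∧ 0 ≤ y₂ ∧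
      c₁ ^ 2 + c₂ ^ 2 = 1 ∧ c₁ * x₁ + c₂ * x₂ = x ∧ c₁ * y₁ + c₂ * y₂ = y ∧
      x₁ ^ 2 + x₂ ^ 2 = x ^ 2 + α ^ 2 ∧ y₁ ^ 2 + y₂ ^ 2 = y ^ 2 + γ ^ 2 ∧
      x₁ * y₁ + x₂ * y₂ = x * y + α * γ := by
  rcases le_or_gt 0 (α * γ) with hs | hs
  · refine ⟨1, 0, x, |α|, y, |γ|, by simp, by simp, hx, abs_nonneg _, hy, abs_nonneg _,
      by simp, by simp, by simp, by simp, by simp, ?_⟩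
    rw [← abs_mul, abs_of_nonneg hs]
  · have hα : α ≠ 0 := by rintro rfl; simp at hs
    have hpos : 0 < x ^ 2 + α ^ 2 := by positivity
    have hN := Real.sqrt_pos.2 hpos
    have hN2 := Real.sq_sqrt hpos.le
    set N := √(x ^ 2 + α ^ 2)
    have hag : |α| * |γ| = -(α * γ) := by rw [← abs_mul, abs_of_neg hs]
    have ha := sq_abs α
    have hg := sq_abs γ
    refine ⟨x / N, |α| / N, N, 0, (x * y + α * γ) / N, (x * |γ| + |α| * y) / N, by positivity,
      by positivity, hN.le, le_rfl, by positivity, by positivity, ?_, ?_, ?_, ?_, ?_, ?_⟩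
    · field_simp
      linear_combination ha - hN2
    · field_simp
      ring
    · field_simp
      linear_combination y * ha + x * hag - y * hN2
    · linear_combination hN2
    · field_simp
      linear_combination (-(y ^ 2 + γ ^ 2)) * hN2 + x ^ 2 * hg + y ^ 2 * ha + 2 * x * y * hag
    · field_simp
      ring

/-- Two plane vectors with Gram matrix `!![p, s; s, q]`, `s < 0`, can be rotated so that the
products of the first coordinates take any prescribed value in `[s, 0]`. -/
theorem exists_gram_split {p q s g : ℝ} (hp : 0 ≤ p) (hpq : s ^ 2 ≤ p * q) (hs : s < 0)
    (hsg : s ≤ g) (hg : g ≤ 0) :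
    ∃ α β γ δ : ℝ, α ^ 2 + β ^ 2 = p ∧ γ ^ 2 + δ ^ 2 = q ∧ α * γ = g ∧ β * δ = s - g := by
  have hp0 : 0 < p := by
    rcases hp.eq_or_lt with h | h
    · rw [← h] at hpq
      nlinarith
    · exact h
  have hsp := Real.sqrt_pos.2 hp0
  have hsp2 := Real.sq_sqrt hp
  have hq : 0 ≤ q - s ^ 2 / p := by
    rw [sub_nonneg, div_le_iff₀ hp0]
    linarith
  have hu2 := Real.sq_sqrt hq
  set P := √p
  set u := √(q - s ^ 2 / p)
  have hq2 : (s / P) ^ 2 + u ^ 2 = q := by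
    rw [hu2, div_pow, hsp2]
    ring
  have hPs : P * (s / P) = s := by field_simp
  set w := s / P
  have hcont : ContinuousOn
      (fun θ : ℝ => P * Real.cos θ * (w * Real.cos θ - u * Real.sin θ))
      (Set.Icc 0 (Real.pi / 2)) := by fun_prop
  obtain ⟨θ, -, hθ⟩ := intermediate_value_Icc (by positivity) hcont
    (show g ∈ _ by simpa [hPs] using ⟨hsg, hg⟩)
  have hcs := Real.sin_sq_add_cos_sq θ
  simp only at hθ
  refine ⟨P * Real.cos θ, P * Real.sin θ, w * Real.cos θ - u * Real.sin θ,
    w * Real.sin θ + u * Real.cos θ, ?_, ?_, hθ, ?_⟩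
  · linear_combination P ^ 2 * hcs + hsp2
  · linear_combination (w ^ 2 + u ^ 2) * hcs + hq2
  · linear_combination P * w * hcs + hPs - hθ

theorem Matrix.PosSemidef.exists_nonneg_factor_fin_four {A : Matrix (Fin 4) (Fin 4) ℝ}
    (hA : A.PosSemidef) (hnn : ∀ i j, 0 ≤ A i j) (hS : ∀ j, 0 ≤ A.schurHead 0 j) :
    ∃ B : Matrix (Fin 4) (Fin 4) ℝ, (∀ i j, 0 ≤ B i j) ∧ A = Bᵀ * B := by
  have hC := hA.schurHead
  have hE := hC.schurHead
  rcases le_or_gt 0 (A.schurHead.schurHead 0 1) with hs | hs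
  · refine hA.exists_nonneg_factor_of_schurHead (hnn 0)
      (hC.exists_nonneg_factor_of_schurHead hS (hE.exists_nonneg_factor_fin_two ?_))
    intro j
    fin_cases j
    · exact hE.diag_nonneg
    · exact hs
  have hsymm : ∀ i j, A j i = A i j := fun i j => by simpa using hA.isHermitian.apply i j
  have hx := Matrix.cholHead_nonneg (hnn 0)
  have hz := Matrix.cholHead_nonneg hS
  have hAx := hA.cholHead_zero_mul
  have hAC := hA.cholHead_mul_add
  have hCz := hC.cholHead_zero_mul
  have hCE := hC.cholHead_mul_add
  have hp : 0 ≤ A.schurHead.schurHead 0 0 := hE.diag_nonneg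
  have hpq := hE.sq_apply_le 0 1
  set C := A.schurHead
  set E := C.schurHead
  set x := A.cholHead
  set z := C.cholHead
  have h₀₀ := hAx 0
  have h₀₁ := hAx 1
  have h₀₂ := hAx 2
  have h₀₃ := hAx 3
  have h₁₁ := hAC 0 0
  have h₁₂ := hAC 0 1
  have h₁₃ := hAC 0 2
  have h₂₂ := hAC 1 1
  have h₂₃ := hAC 1 2
  have h₃₃ := hAC 2 2
  have k₀₀ := hCz 0
  have k₀₁ := hCz 1
  have k₀₂ := hCz 2
  have k₁₁ := hCE 0 0
  have k₁₂ := hCE 0 1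
  have k₂₂ := hCE 1 1
  simp only [Fin.succ_zero_eq_one, Fin.succ_one_eq_two, show Fin.succ (2 : Fin 3) = 3 from rfl]
    at h₁₁ h₁₂ h₁₃ h₂₂ h₂₃ h₃₃ k₁₁ k₁₂ k₂₂
  have hsum : 0 ≤ x 2 * x 3 + z 1 * z 2 + E 0 1 := by linarith [hnn 2 3]
  have hx23 := mul_nonneg (hx 2) (hx 3)
  have hz12 := mul_nonneg (hz 1) (hz 2)
  obtain ⟨α, β, γ, δ, hαβ, hγδ, hαγ, hβδ⟩ := exists_gram_split (g := max (E 0 1) (-(x 2 * x 3)))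
    hp hpq hs (le_max_left _ _) (max_le hs.le (by linarith))
  have hg₁ : -(x 2 * x 3) ≤ α * γ := hαγ ▸ le_max_right _ _
  have hg₂ : 0 ≤ z 1 * z 2 + β * δ := by
    have : max (E 0 1) (-(x 2 * x 3)) ≤ z 1 * z 2 + E 0 1 :=
      max_le (by linarith) (by linarith)
    linarith
  obtain ⟨c₁, c₂, x₁, x₂, y₁, y₂, hc₁, hc₂, hx₁, hx₂, hy₁, hy₂, hc, hcx, hcy, hxx, hyy, hxy⟩ :=
    exists_quadrant_isometry (hx 2) (hx 3) (by linarith : 0 ≤ x 2 * x 3 + α * γ)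
  obtain ⟨d₁, d₂, z₁, z₂, w₁, w₂, hd₁, hd₂, hz₁, hz₂, hw₁, hw₂, hd, hdz, hdw, hzz, hww, hzw⟩ :=
    exists_quadrant_isometry (hz 1) (hz 2) hg₂
  have e₀₀ : A 0 0 = x 0 * c₁ * (x 0 * c₁) + x 0 * c₂ * (x 0 * c₂) := by
    linear_combination -h₀₀ - x 0 ^ 2 * hc
  have e₀₁ : A 0 1 = x 0 * c₁ * (x 1 * c₁) + x 0 * c₂ * (x 1 * c₂) := by
    linear_combination -h₀₁ - x 0 * x 1 * hc
  have e₀₂ : A 0 2 = x 0 * c₁ * x₁ + x 0 * c₂ * x₂ := by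
    linear_combination -h₀₂ - x 0 * hcx
  have e₀₃ : A 0 3 = x 0 * c₁ * y₁ + x 0 * c₂ * y₂ := by
    linear_combination -h₀₃ - x 0 * hcy
  have e₁₁ : A 1 1 = x 1 * c₁ * (x 1 * c₁) + x 1 * c₂ * (x 1 * c₂) + z 0 * d₁ * (z 0 * d₁)
      + z 0 * d₂ * (z 0 * d₂) := by
    linear_combination -h₁₁ - x 1 ^ 2 * hc - k₀₀ - z 0 ^ 2 * hd
  have e₁₂ : A 1 2 = x 1 * c₁ * x₁ + x 1 * c₂ * x₂ + z 0 * d₁ * z₁ + z 0 * d₂ * z₂ := by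
    linear_combination -h₁₂ - x 1 * hcx - k₀₁ - z 0 * hdz
  have e₁₃ : A 1 3 = x 1 * c₁ * y₁ + x 1 * c₂ * y₂ + z 0 * d₁ * w₁ + z 0 * d₂ * w₂ := by
    linear_combination -h₁₃ - x 1 * hcy - k₀₂ - z 0 * hdw
  have e₂₂ : A 2 2 = x₁ * x₁ + x₂ * x₂ + z₁ * z₁ + z₂ * z₂ := by
    linear_combination -h₂₂ - k₁₁ - hxx - hzz - hαβ
  have e₂₃ : A 2 3 = x₁ * y₁ + x₂ * y₂ + z₁ * w₁ + z₂ * w₂ := by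
    linear_combination -h₂₃ - k₁₂ - hxy - hzw - hαγ - hβδ
  have e₃₃ : A 3 3 = y₁ * y₁ + y₂ * y₂ + w₁ * w₁ + w₂ * w₂ := by
    linear_combination -h₃₃ - k₂₂ - hyy - hww - hγδ
  have hx0 := hx 0
  have hx1 := hx 1
  have hz0 := hz 0
  let B : Matrix (Fin 4) (Fin 4) ℝ :=
    !![x 0 * c₁, x 1 * c₁, x₁, y₁; x 0 * c₂, x 1 * c₂, x₂, y₂;
      0, z 0 * d₁, z₁, w₁; 0, z 0 * d₂, z₂, w₂]
  have hle : ∀ i j, i ≤ j → A i j = (Bᵀ * B) i j := by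
    intro i j hij
    fin_cases i <;> fin_cases j <;> first
      | exact absurd hij (by decide)
      | simp [B, Matrix.mul_apply, Fin.sum_univ_four, e₀₀, e₀₁, e₀₂, e₀₃, e₁₁, e₁₂, e₁₃, e₂₂,
          e₂₃, e₃₃]
  refine ⟨B, ?_, ?_⟩
  · intro i j
    fin_cases i <;> fin_cases j <;> simp [B] <;> positivity
  · ext i j
    rcases le_total i j with hij | hij
    · exact hle i j hij
    · rw [hsymm j i, hle j i hij]
      simp only [Matrix.mul_apply, Matrix.transpose_apply, mul_comm]

theorem exists_perm_zero_one {k : ℕ} {i j : Fin (k + 2)} (hij : i ≠ j) :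
    ∃ σ : Equiv.Perm (Fin (k + 2)), σ 0 = i ∧ σ 1 = j := by
  refine ⟨(Equiv.swap 0 i).trans (Equiv.swap (Equiv.swap 0 i 1) j), ?_, by simp⟩
  have h : i ≠ Equiv.swap 0 i 1 := by
    intro h
    have h' : Equiv.swap 0 i 0 = Equiv.swap 0 i 1 := by simpa using h
    exact zero_ne_one ((Equiv.swap 0 i).injective h')
  simp [Equiv.swap_apply_of_ne_of_ne h hij]

/-- Up to a permutation, the Schur complement of the first diagonal entry of a doubly nonnegative
matrix has nonnegative first row: move a pair of minimal correlation to the front. -/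
theorem Matrix.PosSemidef.exists_perm_schurHead_nonneg {k : ℕ}
    {A : Matrix (Fin (k + 2)) (Fin (k + 2)) ℝ} (hA : A.PosSemidef) (hnn : ∀ i j, 0 ≤ A i j)
    (hd : ∀ i, 0 < A i i) :
    ∃ σ : Equiv.Perm (Fin (k + 2)), ∀ j, 0 ≤ (A.submatrix σ σ).schurHead 0 j := by
  obtain ⟨⟨i, j⟩, hij, hmin⟩ := (Finset.univ : Finset (Fin (k + 2))).offDiag.exists_min_image
    (fun q => A q.1 q.2 / (√(A q.1 q.1) * √(A q.2 q.2))) ⟨(0, 1), by simp⟩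
  have hne : i ≠ j := by simpa using hij
  obtain ⟨σ, rfl, rfl⟩ := exists_perm_zero_one hne
  have hA' := hA.submatrix σ
  refine ⟨σ, fun l => ?_⟩
  refine Fin.cases hA'.schurHead.diag_nonneg (fun l => ?_) l
  refine Matrix.schurHead_nonneg (A := A.submatrix σ σ) (hd _) ?_
  have hl : σ 1 ≠ σ l.succ.succ := fun h => by
    have := congrArg Fin.val (σ.injective h)
    simp at this
  have hm := hmin (σ 1, σ l.succ.succ) (by simpa using hl)
  simp only [Matrix.submatrix_apply, Fin.succ_zero_eq_one]
  set a := σ 0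
  set b := σ 1
  set c := σ l.succ.succ
  have ha := Real.sqrt_pos.2 (hd a)
  have hb := Real.sqrt_pos.2 (hd b)
  have hc := Real.sqrt_pos.2 (hd c)
  have ha2 := Real.sq_sqrt (hd a).le
  have hac : A a c ≤ √(A a a) * √(A c c) := by
    rw [← Real.sqrt_mul (hd a).le]
    exact Real.le_sqrt_of_sq_le (hA.sq_apply_le a c)
  simp only at hm
  rw [div_le_div_iff₀ (by positivity) (by positivity)] at hm
  have hm' : A a b * √(A c c) ≤ A b c * √(A a a) := by
    refine le_of_mul_le_mul_right ?_ hb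
    linarith
  calc A a b * A a c ≤ A a b * (√(A a a) * √(A c c)) :=
        mul_le_mul_of_nonneg_left hac (hnn a b)
    _ = √(A a a) * (A a b * √(A c c)) := by ring
    _ ≤ √(A a a) * (A b c * √(A a a)) := mul_le_mul_of_nonneg_left hm' ha.le
    _ = A a a * A b c := by rw [← ha2, Real.sqrt_sq ha.le]; ring

theorem exists_nonneg_factor_of_submatrix_perm {m : ℕ} {A : Matrix (Fin m) (Fin m) ℝ}
    (σ : Equiv.Perm (Fin m))
    (h : ∃ B : Matrix (Fin m) (Fin m) ℝ, (∀ i j, 0 ≤ B i j) ∧ A.submatrix σ σ = Bᵀ * B) :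
    ∃ B : Matrix (Fin m) (Fin m) ℝ, (∀ i j, 0 ≤ B i j) ∧ A = Bᵀ * B := by
  obtain ⟨B, hB, h⟩ := h
  refine ⟨B.submatrix id σ.symm, fun i j => hB _ _, ?_⟩
  ext i j
  have := congrFun (congrFun h (σ.symm i)) (σ.symm j)
  simpa [Matrix.mul_apply] using this

/-- A doubly nonnegative matrix of order `m ≤ 4` with positive diagonal has a square nonnegative
factorization. -/
theorem Matrix.PosSemidef.exists_nonneg_factor_of_le_four {m : ℕ} (hm : m ≤ 4)
    {A : Matrix (Fin m) (Fin m) ℝ} (hA : A.PosSemidef) (hnn : ∀ i j, 0 ≤ A i j)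
    (hd : ∀ i, 0 < A i i) :
    ∃ B : Matrix (Fin m) (Fin m) ℝ, (∀ i j, 0 ≤ B i j) ∧ A = Bᵀ * B := by
  match m, hm with
  | 0, _ => exact ⟨0, fun i => i.elim0, Subsingleton.elim _ _⟩
  | 1, _ => exact hA.exists_nonneg_factor_fin_one
  | 2, _ => exact hA.exists_nonneg_factor_fin_two (hnn 0)
  | 3, _ =>
    obtain ⟨σ, hσ⟩ := hA.exists_perm_schurHead_nonneg hnn hd
    have hA' := hA.submatrix σ
    exact exists_nonneg_factor_of_submatrix_perm σ
      (hA'.exists_nonneg_factor_of_schurHead (fun j => hnn _ _)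
        (hA'.schurHead.exists_nonneg_factor_fin_two hσ))
  | 4, _ =>
    obtain ⟨σ, hσ⟩ := hA.exists_perm_schurHead_nonneg hnn hd
    exact exists_nonneg_factor_of_submatrix_perm σ
      ((hA.submatrix σ).exists_nonneg_factor_fin_four (fun i j => hnn _ _) hσ)

section ColumnCone

open scoped NNReal

variable {n : ℕ} {A : Matrix (Fin n) (Fin n) ℝ}

theorem col_mem_coneOfColumns (A : Matrix (Fin n) (Fin n) ℝ) (j : Fin n) {t : ℝ} (ht : 0 ≤ t) :
    t • A.col j ∈ coneOfColumns A := by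
  refine ⟨Pi.single j t, fun k => ?_, ?_⟩
  · by_cases h : k = j
    · subst h; simpa using ht
    · simp [h]
  · rw [Finset.sum_eq_single j (fun k _ hk => by simp [hk]) (by simp)]
    simp [Matrix.col_def, funext_iff]

theorem coneOfColumns_subset {K : Submodule ℝ≥0 (Fin n → ℝ)} (hK : ∀ j, A.col j ∈ K) :
    coneOfColumns A ⊆ K := by
  rintro x ⟨c, hc, rfl⟩
  exact sum_mem fun j _ => K.smul_mem (⟨c j, hc j⟩ : ℝ≥0) (hK j)

theorem nonneg_of_mem_span_col (hnn : ∀ i j, 0 ≤ A i j) {s : Set (Fin n)} {x : Fin n → ℝ}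
    (hx : x ∈ Submodule.span ℝ≥0 (A.col '' s)) : 0 ≤ x := by
  induction hx using Submodule.span_induction with
  | mem x h =>
    obtain ⟨j, -, rfl⟩ := h
    exact fun i => hnn i j
  | zero => exact le_rfl
  | add x y _ _ hx hy => exact add_nonneg hx hy
  | smul c x _ hx => exact fun i => mul_nonneg c.2 (hx i)

/-- The columns that are extreme in the column cone generate it. -/
theorem exists_span_extreme_cols (hnn : ∀ i j, 0 ≤ A i j) :
    ∃ s : Set (Fin n), (∀ j ∈ s, IsExtremeVec (coneOfColumns A) (A.col j)) ∧
      ∀ j, A.col j ∈ Submodule.span ℝ≥0 (A.col '' s) := by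
  obtain ⟨s, hs, hmin⟩ := exists_minimal_of_wellFoundedLT
    (fun s : Set (Fin n) => ∀ j, A.col j ∈ Submodule.span ℝ≥0 (A.col '' s))
    ⟨Set.univ, fun j => Submodule.subset_span ⟨j, trivial, rfl⟩⟩
  refine ⟨s, fun j hj => ?_, hs⟩
  have himage : A.col '' s = insert (A.col j) (A.col '' (s \ {j})) := by
    rw [← Set.image_insert_eq, Set.insert_sdiff_singleton, Set.insert_eq_of_mem hj]
  have hnot : A.col j ∉ Submodule.span ℝ≥0 (A.col '' (s \ {j})) := by
    intro hmem
    have hall : ∀ l, A.col l ∈ Submodule.span ℝ≥0 (A.col '' (s \ {j})) := by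
      intro l
      have := hs l
      rwa [himage, Submodule.span_insert_eq_span hmem] at this
    exact (hmin hall Set.sdiff_subset hj).2 rfl
  refine ⟨fun h0 => hnot (h0 ▸ zero_mem _), by simpa using col_mem_coneOfColumns A j zero_le_one,
    fun a ha b hb hab => ?_⟩
  have ha' := coneOfColumns_subset hs ha
  have hb' := coneOfColumns_subset hs hb
  rw [himage, SetLike.mem_coe, Submodule.mem_span_insert] at ha' hb'
  obtain ⟨c, y, hy, rfl⟩ := ha'
  obtain ⟨d, z, hz, rfl⟩ := hb'
  have hy0 := nonneg_of_mem_span_col hnn hy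
  have hz0 := nonneg_of_mem_span_col hnn hz
  have heq : ∀ i, A i j = c * A i j + y i + (d * A i j + z i) := fun i => congrFun hab i
  have hcd : 1 ≤ (c : ℝ) + d := by
    by_contra! hlt
    refine hnot ?_
    let e : ℝ≥0 := ⟨(1 - ((c : ℝ) + d))⁻¹, inv_nonneg.2 (by linarith)⟩
    have hmem := Submodule.smul_mem _ e (add_mem hy hz)
    convert hmem using 1
    ext i
    change A i j = (1 - ((c : ℝ) + d))⁻¹ * (y i + z i)
    have : 1 - ((c : ℝ) + d) ≠ 0 := by linarith
    field_simp
    linear_combination heq i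
  refine ⟨c, c.2, ?_⟩
  ext i
  have h₁ : y i = 0 := by
    have := mul_nonneg (sub_nonneg.2 hcd) (hnn i j)
    have h₂ : 0 ≤ y i := hy0 i
    have h₃ : 0 ≤ z i := hz0 i
    linarith [heq i]
  simp [h₁, NNReal.smul_def]

theorem IsExtremeVec.exists_col {v : Fin n → ℝ} (hv : IsExtremeVec (coneOfColumns A) v) :
    ∃ j, ∃ t : ℝ, 0 ≤ t ∧ v = t • A.col j := by
  obtain ⟨hv0, ⟨c, hc, hvc⟩, hdec⟩ := hv
  have hex : ∃ j, c j • A.col j ≠ 0 := by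
    by_contra! h
    exact hv0 (hvc.trans (Finset.sum_eq_zero fun j _ => h j))
  obtain ⟨j, hj⟩ := hex
  obtain ⟨t, ht, htv⟩ := hdec (c j • A.col j) (col_mem_coneOfColumns A j (hc j))
    (∑ k, Function.update c j 0 k • A.col k)
    ⟨Function.update c j 0, fun k => by
      by_cases h : k = j
      · subst h; simp
      · simp [h, hc k], rfl⟩
    (by
      rw [hvc, ← Finset.add_sum_erase _ _ (Finset.mem_univ j),
        ← Finset.add_sum_erase _ (fun k => Function.update c j 0 k • A.col k) (Finset.mem_univ j)]
      simp only [Function.update_self, zero_smul, zero_add]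
      refine congrArg₂ _ rfl (Finset.sum_congr rfl fun k hk => ?_)
      rw [Function.update_of_ne (Finset.ne_of_mem_erase hk)]
      rfl)
  have ht0 : t ≠ 0 := by
    rintro rfl
    exact hj (by simpa using htv)
  refine ⟨j, t⁻¹ * c j, mul_nonneg (inv_nonneg.2 ht) (hc j), ?_⟩
  rw [mul_smul, htv, inv_smul_smul₀ ht0]

end ColumnCone

/-- A nonnegative factorization of a principal submatrix whose columns generate the column cone
extends to the whole matrix. -/
theorem exists_nonneg_factor_of_principal {n m : ℕ} {A : Matrix (Fin n) (Fin n) ℝ}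
    (hsymm : ∀ i j, A j i = A i j) (J : Fin m → Fin n) (N : Matrix (Fin m) (Fin n) ℝ)
    (hN : ∀ i j, 0 ≤ N i j) (hAN : ∀ a j, A a j = ∑ i, N i j * A a (J i))
    {B : Matrix (Fin m) (Fin m) ℝ} (hB : ∀ i j, 0 ≤ B i j) (h : A.submatrix J J = Bᵀ * B) :
    ∃ B' : Matrix (Fin m) (Fin n) ℝ, (∀ i j, 0 ≤ B' i j) ∧ A = B'ᵀ * B' := by
  refine ⟨B * N, fun i j => ?_, ?_⟩
  · rw [Matrix.mul_apply]
    exact Finset.sum_nonneg fun l _ => mul_nonneg (hB _ _) (hN _ _)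
  have h₁ : A = A.submatrix id J * N := by
    ext a j
    simp [Matrix.mul_apply, hAN a j, mul_comm]
  have h₂ : A.submatrix id J = Nᵀ * A.submatrix J J := by
    ext a i
    simp only [Matrix.mul_apply, Matrix.submatrix_apply, Matrix.transpose_apply, id]
    rw [hsymm, hAN (J i) a]
    exact Finset.sum_congr rfl fun l _ => by rw [hsymm]
  calc A = Nᵀ * A.submatrix J J * N := by rw [← h₂, ← h₁]
    _ = (B * N)ᵀ * (B * N) := by rw [h, Matrix.transpose_mul]; simp only [Matrix.mul_assoc]

theorem stmt_18 (n r m : ℕ) (hm : m ≤ 4) (A : Matrix (Fin n) (Fin n) ℝ)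
    (hnn : ∀ i j, 0 ≤ A i j) (hpsd : A.PosSemidef) (hrank : A.rank = r)
    (v : Fin m → Fin n → ℝ)
    (hext : ∀ i, IsExtremeVec (coneOfColumns A) (v i))
    (hdist : ∀ i j, i ≠ j → ∀ t : ℝ, v i ≠ t • v j)
    (hall : ∀ w, IsExtremeVec (coneOfColumns A) w → ∃ i, ∃ t : ℝ, 0 < t ∧ w = t • v i) :
    A.IsCP ∧ A.cpRank ≤ m := by
  have hsymm : ∀ i j, A j i = A i j := fun i j => by simpa using hpsd.isHermitian.apply i j
  choose J t ht hJ using fun i => (hext i).exists_col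
  obtain ⟨s, hs, hspan⟩ := exists_span_extreme_cols hnn
  have hmem : ∀ j, A.col j ∈ Submodule.span NNReal (Set.range v) := by
    intro j
    refine Submodule.span_le.2 ?_ (hspan j)
    rintro _ ⟨k, hk, rfl⟩
    obtain ⟨i, τ, hτ, h⟩ := hall _ (hs k hk)
    rw [h]
    exact Submodule.smul_mem _ (⟨τ, hτ.le⟩ : NNReal) (Submodule.subset_span ⟨i, rfl⟩)
  choose N hN using fun j => (Submodule.mem_span_range_iff_exists_fun NNReal).1 (hmem j)
  have hd : ∀ i, 0 < A (J i) (J i) := by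
    intro i
    refine lt_of_le_of_ne (hnn _ _) fun h0 => (hext i).1 ?_
    rw [hJ i]
    ext a
    have h := hpsd.sq_apply_le a (J i)
    rw [← h0] at h
    have : A a (J i) = 0 := by nlinarith
    simp [this]
  obtain ⟨B, hB, hAB⟩ := (hpsd.submatrix J).exists_nonneg_factor_of_le_four hm
    (fun i j => hnn _ _) hd
  have hfac : ∃ B : Matrix (Fin m) (Fin n) ℝ, (∀ i j, 0 ≤ B i j) ∧ A = Bᵀ * B := by
    refine exists_nonneg_factor_of_principal hsymm J (fun i j => N j i * t i)
      (fun i j => mul_nonneg (N j i).2 (ht i)) (fun a j => ?_) hB hAB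
    have h := congrFun (hN j) a
    rw [Finset.sum_apply] at h
    rw [show A a j = A.col j a from rfl, ← h]
    refine Finset.sum_congr rfl fun i _ => ?_
    rw [hJ i]
    simp [NNReal.smul_def, mul_assoc]
  exact ⟨⟨m, hfac⟩, Nat.sInf_le hfac⟩
end
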